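/- Let g : X → (0,1) be continuous with Σ_{a∈A} g(ax) = 1 for all x ∈ X, set φ = log g, and let μ be a probability measure on X with ∫ L_φ f dμ = ∫ f dμ for all continuous f : X → ℝ (an equilibrium state of φ). Then the limit γ^+(μ) = lim_n (1/n) log max_{a_1^n ∈ A^n} μ(a_1^n) exists, and γ^+(μ) = sup_η ∫ φ dη, where the supremum, which is attained, runs over all shift-invariant Borel probability measures η on X. -/

import Mathlib

open MeasureTheory Filter Topology Set

namespace RTSpec

variable (A : Type*) [Fintype A] [TopologicalSpace A] [DiscreteTopology A]
  [MeasurableSpace A] [BorelSpace A]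

/-- The sequence space `X = A^ℕ` (0-indexed: `x 0` is the paper's `x₁`). -/
abbrev X := ℕ → A

/-- The shift map `θ`. -/
def shift : X A → X A := fun x n => x (n + 1)

/-- The cylinder `[a_1^n]` based on the word `w = a_1^n`. -/
def cyl {n : ℕ} (w : Fin n → A) : Set (X A) := {x | ∀ i : Fin n, x i.val = w i}

/-- Return time `R_n(x) = inf {k ≥ 2 : x_k^{k+n-1} = x_1^n}` (with `sInf ∅ = 0`). -/
noncomputable def retTime (n : ℕ) (x : X A) : ℕ := sInf {k | 2 ≤ k ∧ ∀ i < n, x (k - 1 + i) = x i}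

/-- Hitting time `T_{a_1^n}(y) = inf {k ≥ 1 : y_k^{k+n-1} = a_1^n}`. -/
noncomputable def hitTime {n : ℕ} (w : Fin n → A) (y : X A) : ℕ :=
  sInf {k | 1 ≤ k ∧ ∀ i : Fin n, y (k - 1 + i.val) = w i}

/-- Hitting/return time in the shifted sense: `inf {k ≥ 1 : θ^k y ∈ [a_1^n]}`. -/
noncomputable def hitTime' {n : ℕ} (w : Fin n → A) (y : X A) : ℕ :=
  sInf {k | 1 ≤ k ∧ ∀ i : Fin n, y (k + i.val) = w i}

/-- `τ(a_1^n) = inf {k ≥ 1 : [a_1^n] ∩ θ^{-k}[a_1^n] ≠ ∅}`, the smallest return time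
of the cylinder `[a_1^n]`. -/
noncomputable def tau {n : ℕ} (w : Fin n → A) : ℕ :=
  sInf {k | 1 ≤ k ∧ (cyl A w ∩ {y | ∀ i : Fin n, y (k + i.val) = w i}).Nonempty}

/-- `ζ_μ(a_1^n) = μ([a_1^n] ∩ {T_{a_1^n} ≠ τ(a_1^n)}) / μ([a_1^n])`. -/
noncomputable def zeta (μ : Measure (X A)) {n : ℕ} (w : Fin n → A) : ℝ :=
  (μ (cyl A w ∩ {y | hitTime' A w y ≠ tau A w})).toReal / (μ (cyl A w)).toReal

/-- A shift-invariant Borel probability measure. -/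
def InvProb (η : Measure (X A)) : Prop :=
  IsProbabilityMeasure η ∧ Measure.map (shift A) η = η

/-- The `n`-th term `-(1/n) Σ_{a_1^n} μ(a_1^n) log μ(a_1^n)` of the entropy sequence. -/
noncomputable def entSeq (μ : Measure (X A)) (n : ℕ) : ℝ :=
  -(1 / (n : ℝ)) * ∑ w : Fin n → A, (μ (cyl A w)).toReal * Real.log (μ (cyl A w)).toReal

/-- The entropy `h(μ)`, i.e. the limit of `entSeq` (which always exists for a
shift-invariant measure; we realize it as a liminf). -/
noncomputable def entropy (μ : Measure (X A)) : ℝ := atTop.liminf (entSeq A μ)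

/-- Topological pressure `P(ψ) = sup_η {h(η) + ∫ ψ dη}`, the supremum running over
all shift-invariant probability measures. -/
noncomputable def pressure (ψ : X A → ℝ) : ℝ :=
  sSup {r | ∃ η : Measure (X A), InvProb A η ∧ r = entropy A η + ∫ x, ψ x ∂η}

/-- `sup_η ∫ φ dη` over shift-invariant probability measures. -/
noncomputable def supInt (φ : X A → ℝ) : ℝ :=
  sSup {r | ∃ η : Measure (X A), InvProb A η ∧ r = ∫ x, φ x ∂η}

/-- `inf_η ∫ φ dη` over shift-invariant probability measures. -/
noncomputable def infInt (φ : X A → ℝ) : ℝ :=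
  sInf {r | ∃ η : Measure (X A), InvProb A η ∧ r = ∫ x, φ x ∂η}

/-- `var_n(φ) = sup {|φ(x) - φ(y)| : x_1^n = y_1^n}`. -/
noncomputable def Var (φ : X A → ℝ) (n : ℕ) : ℝ :=
  sSup {r | ∃ x y : X A, (∀ i < n, x i = y i) ∧ r = |φ x - φ y|}

/-- Prepending a symbol: `ax = (a, x_1, x_2, …)`. -/
def prepend (a : A) (x : X A) : X A := fun n => Nat.casesOn n a x

/-- A potential `φ` is normalized if `Σ_{a ∈ A} e^{φ(ax)} = 1` for all `x`. -/
def Normalized (φ : X A → ℝ) : Prop :=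
  ∀ x : X A, ∑ a : A, Real.exp (φ (prepend A a x)) = 1

/-- `μ` is an equilibrium state for `φ`: a probability measure fixed by the dual
transfer operator, i.e. `∫ L_φ f dμ = ∫ f dμ` for every continuous `f`. -/
def IsEqSt (φ : X A → ℝ) (μ : Measure (X A)) : Prop :=
  IsProbabilityMeasure μ ∧ ∀ f : X A → ℝ, Continuous f →
    ∫ x, (∑ a : A, Real.exp (φ (prepend A a x)) * f (prepend A a x)) ∂μ = ∫ x, f x ∂μ

/-- The `n`-th term `(1/n) log ∫ R_n^q dμ` of the return-time `L^q`-spectrum,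
with values in `EReal` (the integral may be infinite). -/
noncomputable def RSeq (μ : Measure (X A)) (q : ℝ) (n : ℕ) : EReal :=
  (((n : ℝ)⁻¹ : ℝ) : EReal) *
    ENNReal.log (∫⁻ x, ENNReal.ofReal ((retTime A n x : ℝ) ^ q) ∂μ)

/-- The `n`-th term `(1/n) log Σ_{a_1^n} μ(a_1^n)^{1-q}` of the `L^q`-spectrum of `μ`. -/
noncomputable def MSeq (μ : Measure (X A)) (q : ℝ) (n : ℕ) : ℝ :=
  (1 / (n : ℝ)) * Real.log (∑ w : Fin n → A, (μ (cyl A w)).toReal ^ (1 - q))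

/-- `Λ^{(n)}(μ) = (1/n) log Σ_{a_1^n} (1 - ζ_μ(a_1^n)) μ(a_1^n)`. -/
noncomputable def LamSeq (μ : Measure (X A)) (n : ℕ) : ℝ :=
  (1 / (n : ℝ)) * Real.log (∑ w : Fin n → A, (1 - zeta A μ w) * (μ (cyl A w)).toReal)

/-- `(1/n) log max_{a_1^n} μ(a_1^n)`. -/
noncomputable def gammaSeq (μ : Measure (X A)) (n : ℕ) : ℝ :=
  (1 / (n : ℝ)) * Real.log (⨆ w : Fin n → A, (μ (cyl A w)).toReal)

/-- `μ` is φ-mixing with rate `ϕ`: `ϕ` decreases to `0` and for all `n, ℓ ≥ 1`,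
all `S` in the σ-algebra generated by coordinates `1, …, n` with `μ S ≠ 0`, and
all `T` in the σ-algebra generated by coordinates `n+ℓ, n+ℓ+1, …`,
`|μ(S ∩ T)/μ(S) - μ(T)| ≤ ϕ(ℓ)`. -/
def PhiMixing (μ : Measure (X A)) (ϕ : ℕ → ℝ) : Prop :=
  (∀ ℓ, 0 < ϕ ℓ) ∧ Antitone ϕ ∧ Tendsto ϕ atTop (nhds 0) ∧
  ∀ n ℓ : ℕ, 1 ≤ n → 1 ≤ ℓ →
    ∀ S T : Set (X A),
      MeasurableSet[MeasurableSpace.comap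
        (fun x : X A => fun i : Fin n => x i.val) inferInstance] S →
      MeasurableSet[MeasurableSpace.comap
        (fun x : X A => fun j : ℕ => x (n + ℓ - 1 + j)) inferInstance] T →
      μ S ≠ 0 →
      |(μ (S ∩ T)).toReal / (μ S).toReal - (μ T).toReal| ≤ ϕ ℓ

set_option linter.unusedSectionVars false

/-- Krylov–Bogoliubov: a continuous self-map of a compact space has an invariant probability
measure that integrates every continuous `φ` to the limit of the Birkhoff averages of `φ` along
given starting points, whenever that limit exists. -/
theorem exists_invariant_integral_eq_of_tendsto_birkhoffSum {Y : Type*} [TopologicalSpace Y]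
    [CompactSpace Y] [T2Space Y] [MeasurableSpace Y] [BorelSpace Y] [HasOuterApproxClosed Y]
    {T : Y → Y} (hT : Continuous T) (x : ℕ → Y) :
    ∃ η : Measure Y, IsProbabilityMeasure η ∧ Measure.map T η = η ∧
      ∀ (φ : Y → ℝ) (_ : Continuous φ) (γ : ℝ),
        Tendsto (fun n : ℕ => birkhoffSum T φ n (x n) / n) atTop (𝓝 γ) →
        ∫ y, φ y ∂η = γ := by
  let m : ℕ → Measure Y := fun n => ∑ k ∈ Finset.range (n + 1),
    ((n + 1 : ℕ) : ENNReal)⁻¹ • Measure.dirac (T^[k] (x (n + 1)))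
  have hm : ∀ n, IsProbabilityMeasure (m n) := fun n => ⟨by
    simp only [m, Measure.coe_finsetSum, Finset.sum_apply, Measure.smul_apply, measure_univ,
      smul_eq_mul, mul_one, Finset.sum_const, Finset.card_range, nsmul_eq_mul]
    exact ENNReal.mul_inv_cancel (by simp) (ENNReal.natCast_ne_top _)⟩
  have hint : ∀ n (f : Y → ℝ), Continuous f →
      ∫ y, f y ∂(m n) = birkhoffSum T f (n + 1) (x (n + 1)) / ((n + 1 : ℕ) : ℝ) := by
    intro n f hf
    rw [integral_finsetSum_measure]
    · simp only [integral_smul_measure, integral_dirac, birkhoffSum, Finset.sum_div,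
        ENNReal.toReal_inv, ENNReal.toReal_natCast, smul_eq_mul]
      exact Finset.sum_congr rfl fun k _ => by rw [div_eq_inv_mul]
    · intro k _
      exact (integrable_dirac (by simp)).smul_measure (by simp)
  let ν : ℕ → ProbabilityMeasure Y := fun n => ⟨m n, hm n⟩
  let U : Ultrafilter ℕ := hyperfilter ℕ
  have hU : (U : Filter ℕ) ≤ atTop := by
    rw [← Nat.cofinite_eq_atTop]; exact hyperfilter_le_cofinite
  obtain ⟨η, -, hη⟩ := isCompact_univ.ultrafilter_le_nhds (U.map ν) (by simp)
  have hη' : Tendsto ν U (𝓝 η) := hη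
  rw [ProbabilityMeasure.tendsto_iff_forall_integral_tendsto] at hη'
  have hlim : ∀ f : Y → ℝ, Continuous f →
      Tendsto (fun n : ℕ => birkhoffSum T f (n + 1) (x (n + 1)) / ((n + 1 : ℕ) : ℝ)) U
        (𝓝 (∫ y, f y ∂(η : Measure Y))) := by
    intro f hf
    refine (hη' (BoundedContinuousFunction.mkOfCompact ⟨f, hf⟩)).congr fun n => ?_
    exact hint n f hf
  refine ⟨η, inferInstance, ?_, fun φ hφ γ hγ => ?_⟩
  · have : IsProbabilityMeasure (Measure.map T (η : Measure Y)) :=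
      Measure.isProbabilityMeasure_map hT.measurable.aemeasurable
    refine ext_of_forall_integral_eq_of_IsFiniteMeasure fun f => ?_
    rw [integral_map hT.measurable.aemeasurable f.continuous.aestronglyMeasurable]
    refine sub_eq_zero.1 (tendsto_nhds_unique
      ((hlim (fun y => f (T y)) (f.continuous.comp hT)).sub (hlim f f.continuous)) ?_)
    refine Tendsto.mono_left ?_ hU
    have h0 : Tendsto (fun n : ℕ => 2 * ‖f‖ / ((n + 1 : ℕ) : ℝ)) atTop (𝓝 0) :=
      (tendsto_const_div_atTop_nhds_zero_nat (2 * ‖f‖)).comp (tendsto_add_atTop_nat 1)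
    refine squeeze_zero_norm (fun n => ?_) h0
    have key : birkhoffSum T (fun y => f (T y)) (n + 1) (x (n + 1))
        - birkhoffSum T f (n + 1) (x (n + 1)) = f (T^[n + 1] (x (n + 1))) - f (x (n + 1)) := by
      rw [← birkhoffSum_apply_sub_birkhoffSum]
      congr 1
      exact Finset.sum_congr rfl fun k _ => by
        rw [← Function.iterate_succ_apply, Function.iterate_succ_apply']
    rw [← sub_div, key, norm_div, Real.norm_natCast]
    gcongr
    calc ‖f (T^[n + 1] (x (n + 1))) - f (x (n + 1))‖ ≤ ‖f _‖ + ‖f _‖ := norm_sub_le _ _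
      _ ≤ 2 * ‖f‖ := by
        rw [two_mul]; exact add_le_add (f.norm_coe_le_norm _) (f.norm_coe_le_norm _)
  · exact tendsto_nhds_unique (hlim φ hφ) ((hγ.comp (tendsto_add_atTop_nat 1)).mono_left hU)

theorem continuous_birkhoffSum {Y M : Type*} [TopologicalSpace Y] [TopologicalSpace M]
    [AddCommMonoid M] [ContinuousAdd M] {T : Y → Y} (hT : Continuous T) {φ : Y → M}
    (hφ : Continuous φ) (n : ℕ) : Continuous (birkhoffSum T φ n) :=
  continuous_finsetSum _ fun k _ => hφ.comp (hT.iterate k)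

theorem integral_birkhoffSum {Y : Type*} [MeasurableSpace Y] {η : Measure Y} {T : Y → Y}
    (hT : MeasurePreserving T η η) {φ : Y → ℝ} (hφ : Integrable φ η) (n : ℕ) :
    ∫ y, birkhoffSum T φ n y ∂η = n * ∫ y, φ y ∂η := by
  simp only [birkhoffSum]
  rw [integral_finsetSum]
  · have : ∀ k, ∫ y, φ (T^[k] y) ∂η = ∫ y, φ y ∂η := fun k => by
      have hk := hT.iterate k
      have := integral_map (μ := η) (φ := T^[k]) (f := φ) hk.measurable.aemeasurable
        (by rw [hk.map_eq]; exact hφ.aestronglyMeasurable)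
      rw [← this, hk.map_eq]
    simp [this]
  · intro k _
    exact (hT.iterate k).integrable_comp_of_integrable hφ

theorem continuous_shift : Continuous (shift A) :=
  continuous_pi fun n => continuous_apply (n + 1)

theorem shift_prepend (a : A) (x : X A) : shift A (prepend A a x) = x := rfl

theorem isClopen_cyl {n : ℕ} (w : Fin n → A) : IsClopen (cyl A w) := by
  have : cyl A w = ⋂ i : Fin n, (fun x : X A => x i.val) ⁻¹' {w i} := by
    ext x; simp [cyl]
  rw [this]
  exact isClopen_iInter_of_finite fun i =>
    (isClopen_discrete _).preimage (continuous_apply _)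

theorem prepend_mem_cyl_iff {n : ℕ} (w : Fin (n + 1) → A) (a : A) (x : X A) :
    prepend A a x ∈ cyl A w ↔ a = w 0 ∧ x ∈ cyl A (Fin.tail w) := by
  simp only [cyl, Set.mem_ofPred_eq, Fin.forall_fin_succ, Fin.tail]
  rfl

/-- An equilibrium state integrates `exp (-S_n φ)` over any cylinder of length `n` to `1`. -/
theorem IsEqSt.setIntegral_exp_neg_birkhoffSum {φ : X A → ℝ} (hφ : Continuous φ)
    {μ : Measure (X A)} (hμ : IsEqSt A φ μ) {n : ℕ} (w : Fin n → A) :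
    ∫ x in cyl A w, Real.exp (-birkhoffSum (shift A) φ n x) ∂μ = 1 := by
  classical
  have := hμ.1
  induction n with
  | zero =>
    have : cyl A w = univ := by ext x; simp [cyl]
    simp [this]
  | succ n ih =>
    rw [← ih (Fin.tail w), ← integral_indicator (isClopen_cyl A w).isOpen.measurableSet,
      ← integral_indicator (isClopen_cyl A _).isOpen.measurableSet, ← hμ.2]
    · refine integral_congr_ae (Eventually.of_forall fun x => ?_)
      have hterm : ∀ a, Real.exp (φ (prepend A a x)) *
          (cyl A w).indicator (fun x => Real.exp (-birkhoffSum (shift A) φ (n + 1) x))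
            (prepend A a x) = if a = w 0 then (cyl A (Fin.tail w)).indicator
              (fun x => Real.exp (-birkhoffSum (shift A) φ n x)) x else 0 := by
        intro a
        simp only [Set.indicator_apply, prepend_mem_cyl_iff]
        by_cases ha : a = w 0 <;> by_cases hx : x ∈ cyl A (Fin.tail w) <;>
          simp [ha, hx, birkhoffSum_succ', shift_prepend, Real.exp_add, Real.exp_neg]
        field_simp
      simp [hterm]
    · exact (Real.continuous_exp.comp
        (continuous_birkhoffSum (continuous_shift A) hφ _).neg).indicator (by
          simp [(isClopen_cyl A w).frontier_eq])

theorem IsEqSt.measureReal_cyl_le {φ : X A → ℝ} (hφ : Continuous φ)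
    {μ : Measure (X A)} (hμ : IsEqSt A φ μ) {n : ℕ} (w : Fin n → A) {c : ℝ}
    (hc : ∀ x ∈ cyl A w, birkhoffSum (shift A) φ n x ≤ c) :
    (μ (cyl A w)).toReal ≤ Real.exp c := by
  have := hμ.1
  have hcont := Real.continuous_exp.comp
    (continuous_birkhoffSum (continuous_shift A) hφ n).neg
  have h : ∫ x in cyl A w, Real.exp (-c) ∂μ ≤ 1 := by
    rw [← hμ.setIntegral_exp_neg_birkhoffSum A hφ w]
    refine setIntegral_mono_on (by simp) ?_ (isClopen_cyl A w).isOpen.measurableSet fun x hx => ?_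
    · exact (hcont.integrable_of_hasCompactSupport
        (HasCompactSupport.of_compactSpace _)).integrableOn
    · exact Real.exp_le_exp.2 (neg_le_neg (hc x hx))
  rw [setIntegral_const, smul_eq_mul, Real.exp_neg, ← div_eq_mul_inv,
    div_le_one (Real.exp_pos c)] at h
  exact h

theorem IsEqSt.le_measureReal_cyl {φ : X A → ℝ} (hφ : Continuous φ)
    {μ : Measure (X A)} (hμ : IsEqSt A φ μ) {n : ℕ} (w : Fin n → A) {c : ℝ}
    (hc : ∀ x ∈ cyl A w, c ≤ birkhoffSum (shift A) φ n x) :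
    Real.exp c ≤ (μ (cyl A w)).toReal := by
  have := hμ.1
  have hcont := Real.continuous_exp.comp
    (continuous_birkhoffSum (continuous_shift A) hφ n).neg
  have h : 1 ≤ ∫ x in cyl A w, Real.exp (-c) ∂μ := by
    rw [← hμ.setIntegral_exp_neg_birkhoffSum A hφ w]
    refine setIntegral_mono_on ?_ (by simp) (isClopen_cyl A w).isOpen.measurableSet fun x hx => ?_
    · exact (hcont.integrable_of_hasCompactSupport
        (HasCompactSupport.of_compactSpace _)).integrableOn
    · exact Real.exp_le_exp.2 (neg_le_neg (hc x hx))
  rw [setIntegral_const, smul_eq_mul, Real.exp_neg, ← div_eq_mul_inv,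
    one_le_div (Real.exp_pos c)] at h
  exact h

/-- A continuous potential varies little between points sharing a long prefix. -/
theorem exists_forall_abs_sub_le_of_eqOn_prefix {φ : X A → ℝ} (hφ : Continuous φ) {ε : ℝ}
    (hε : 0 < ε) : ∃ N : ℕ, ∀ x y : X A, (∀ i < N, x i = y i) → |φ x - φ y| ≤ ε := by
  by_contra! h
  choose x y hxy hd using h
  let U : Ultrafilter ℕ := hyperfilter ℕ
  have hU : (U : Filter ℕ) ≤ atTop := by
    rw [← Nat.cofinite_eq_atTop]; exact hyperfilter_le_cofinite
  obtain ⟨z, -, hz⟩ := isCompact_univ.ultrafilter_le_nhds (U.map x) (by simp)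
  have hx : Tendsto x U (𝓝 z) := hz
  have hy : Tendsto y U (𝓝 z) := by
    rw [tendsto_pi_nhds] at hx ⊢
    intro i
    refine (hx i).congr' (hU ?_)
    filter_upwards [eventually_gt_atTop i] with n hn using hxy n i hn
  have hlim := (((hφ.tendsto z).comp hx).sub ((hφ.tendsto z).comp hy)).abs
  rw [sub_self, abs_zero] at hlim
  obtain ⟨n, hn⟩ := (hlim.eventually (gt_mem_nhds hε)).exists
  exact (hd n).not_gt hn

theorem abs_birkhoffSum_sub_le_of_eqOn_prefix {φ : X A → ℝ} {C ε : ℝ} {N : ℕ} (hε : 0 ≤ ε)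
    (hC : ∀ x y, |φ x - φ y| ≤ C)
    (hN : ∀ x y : X A, (∀ i < N, x i = y i) → |φ x - φ y| ≤ ε) (n : ℕ) (x y : X A)
    (hxy : ∀ i < n, x i = y i) :
    |birkhoffSum (shift A) φ n x - birkhoffSum (shift A) φ n y| ≤ n * ε + (min n N : ℕ) * C := by
  have hC0 : 0 ≤ C := (abs_nonneg _).trans (hC x y)
  induction n generalizing x y with
  | zero => simp
  | succ n ih =>
    have h1 := ih (shift A x) (shift A y) fun i hi => hxy (i + 1) (by omega)
    rw [birkhoffSum_succ', birkhoffSum_succ', add_sub_add_comm]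
    refine (abs_add_le _ _).trans ?_
    push_cast at h1 ⊢
    rcases le_or_gt N n with h | h
    · have h2 := hN x y fun i hi => hxy i (by omega)
      have h' : (N : ℝ) ≤ n := by exact_mod_cast h
      rw [min_eq_right h'] at h1
      rw [min_eq_right (by linarith)]
      linarith
    · have h2 := hC x y
      have h' : (n : ℝ) + 1 ≤ N := by exact_mod_cast h
      rw [min_eq_left (by linarith)] at h1
      rw [min_eq_left h']
      linarith

/-- The exponential rate of the largest cylinder is that of the largest Birkhoff sum. -/
theorem IsEqSt.tendsto_gammaSeq {φ : X A → ℝ} (hφ : Continuous φ) {μ : Measure (X A)}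
    (hμ : IsEqSt A φ μ) {x : ℕ → X A}
    (hx : ∀ n y, birkhoffSum (shift A) φ n y ≤ birkhoffSum (shift A) φ n (x n)) {γ : ℝ}
    (hγ : Tendsto (fun n : ℕ => birkhoffSum (shift A) φ n (x n) / n) atTop (𝓝 γ)) :
    Tendsto (gammaSeq A μ) atTop (𝓝 γ) := by
  have := hμ.1
  have : Nonempty (X A) := ⟨x 0⟩
  obtain ⟨B, hB⟩ := (isCompact_range hφ).isBounded.exists_norm_le
  have hC : ∀ x y, |φ x - φ y| ≤ B + B := fun x y =>
    (norm_sub_le _ _).trans (add_le_add (hB _ ⟨x, rfl⟩) (hB _ ⟨y, rfl⟩))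
  have hbdd : ∀ n, BddAbove (range fun w : Fin n → A => (μ (cyl A w)).toReal) := fun n =>
    (finite_range _).bddAbove
  have hne : ∀ n, Nonempty (Fin n → A) := fun n => ⟨fun i => x 0 i⟩
  have hpos : ∀ n, 0 < ⨆ w : Fin n → A, (μ (cyl A w)).toReal := fun n =>
    (Real.exp_pos _).trans_le ((hμ.le_measureReal_cyl A hφ (fun i : Fin n => x 0 i)
      (c := -(n * B)) fun y _ => by
        rw [neg_le]
        refine (neg_le_abs _).trans ((Finset.abs_sum_le_sum_abs _ _).trans ?_)
        refine (Finset.sum_le_card_nsmul _ _ B fun k _ => hB _ ⟨_, rfl⟩).trans ?_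
        simp).trans (le_ciSup (hbdd n) _))
  have hle : ∀ n, gammaSeq A μ n ≤ birkhoffSum (shift A) φ n (x n) / n := fun n => by
    rw [gammaSeq, one_div, inv_mul_eq_div]
    gcongr
    rw [Real.log_le_iff_le_exp (hpos n)]
    exact ciSup_le fun w => hμ.measureReal_cyl_le A hφ w fun y _ => hx n y
  have hge : ∀ ε > 0, ∃ D : ℝ, ∀ n : ℕ, 0 < n →
      birkhoffSum (shift A) φ n (x n) / n - ε - D / n ≤ gammaSeq A μ n := by
    intro ε hε
    obtain ⟨N, hN⟩ := exists_forall_abs_sub_le_of_eqOn_prefix A hφ hε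
    refine ⟨N * (B + B), fun n hn => ?_⟩
    have hn' : (0 : ℝ) < n := by exact_mod_cast hn
    have hkey : birkhoffSum (shift A) φ n (x n) - n * ε - N * (B + B) ≤
        Real.log (⨆ w : Fin n → A, (μ (cyl A w)).toReal) := by
      rw [Real.le_log_iff_exp_le (hpos n)]
      refine (hμ.le_measureReal_cyl A hφ (fun i : Fin n => x n i) fun y hy => ?_).trans
        (le_ciSup (hbdd n) _)
      have h1 := abs_birkhoffSum_sub_le_of_eqOn_prefix A hε.le hC hN n (x n) y
        fun i hi => (hy ⟨i, hi⟩).symm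
      have h2 : ((min n N : ℕ) : ℝ) * (B + B) ≤ N * (B + B) := by
        have : 0 ≤ B + B := (abs_nonneg _).trans (hC (x 0) (x 0))
        gcongr
        exact min_le_right _ _
      linarith [le_abs_self (birkhoffSum (shift A) φ n (x n) - birkhoffSum (shift A) φ n y)]
    rw [gammaSeq, one_div, inv_mul_eq_div, le_div_iff₀ hn', sub_mul, sub_mul,
      div_mul_cancel₀ _ hn'.ne', div_mul_cancel₀ _ hn'.ne']
    linarith
  refine tendsto_order.2 ⟨fun a ha => ?_, fun a ha => ?_⟩
  · obtain ⟨D, hD⟩ := hge ((γ - a) / 2) (by linarith)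
    have hlim := (hγ.sub_const ((γ - a) / 2)).sub (tendsto_const_div_atTop_nhds_zero_nat D)
    filter_upwards [hlim.eventually (lt_mem_nhds (a := a) (by linarith)),
      eventually_gt_atTop 0] with n hn hn0 using hn.trans_le (hD n hn0)
  · filter_upwards [hγ.eventually (gt_mem_nhds ha)] with n hn using (hle n).trans_lt hn


/-- for an equilibrium state `μ` of `φ = log g` (with `g` a
continuous `g`-function), `γ⁺(μ) = lim_n (1/n) log max_{a_1^n} μ(a_1^n)` exists and
equals `sup_η ∫ φ dη`, the supremum being attained. -/
theorem min_entropy_variational_principle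
    (hcard : 1 < Fintype.card A)
    (g : X A → ℝ) (hgc : Continuous g) (hg01 : ∀ x, g x ∈ Set.Ioo (0 : ℝ) 1)
    (hgsum : ∀ x : X A, ∑ a : A, g (prepend A a x) = 1)
    (μ : Measure (X A)) (hμ : IsEqSt A (fun x => Real.log (g x)) μ) :
    ∃ γ : ℝ, Tendsto (gammaSeq A μ) atTop (nhds γ) ∧
      γ = supInt A (fun x => Real.log (g x)) ∧
      ∃ η : Measure (X A), InvProb A η ∧ ∫ x, Real.log (g x) ∂η = γ := by
  have hA : Nonempty A := Fintype.card_pos_iff.1 (by omega)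
  set φ : X A → ℝ := fun x => Real.log (g x) with hφdef
  have hφ : Continuous φ := hgc.log fun x => (hg01 x).1.ne'
  have hmax : ∀ n, ∃ x, ∀ y, birkhoffSum (shift A) φ n y ≤ birkhoffSum (shift A) φ n x := by
    intro n
    obtain ⟨x, -, hx⟩ := isCompact_univ.exists_isMaxOn univ_nonempty
      (continuous_birkhoffSum (continuous_shift A) hφ n).continuousOn
    exact ⟨x, fun y => hx (mem_univ y)⟩
  choose x hx using hmax
  obtain ⟨B, hB⟩ := (isCompact_range hφ).isBounded.exists_norm_le
  have hsub : Subadditive fun n => birkhoffSum (shift A) φ n (x n) := fun m n => by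
    dsimp only
    rw [birkhoffSum_add]
    exact add_le_add (hx m _) (hx n _)
  have hbdd : BddBelow (range fun n : ℕ => birkhoffSum (shift A) φ n (x n) / n) := by
    refine ⟨-B, ?_⟩
    rintro _ ⟨n, rfl⟩
    have hB0 : 0 ≤ B := (norm_nonneg _).trans (hB _ ⟨x 0, rfl⟩)
    rcases n.eq_zero_or_pos with rfl | hn
    · simpa using hB0
    · have hn' : (0 : ℝ) < n := by exact_mod_cast hn
      rw [le_div_iff₀ hn', neg_mul, neg_le]
      refine (neg_le_abs _).trans ((Finset.abs_sum_le_sum_abs _ _).trans ?_)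
      refine (Finset.sum_le_card_nsmul _ _ B fun k _ => hB _ ⟨_, rfl⟩).trans ?_
      simp [mul_comm]
  have hγ := hsub.tendsto_lim hbdd
  obtain ⟨η, hη, hηinv, hηint⟩ :=
    exists_invariant_integral_eq_of_tendsto_birkhoffSum (continuous_shift A) x
  have hηγ := hηint φ hφ _ hγ
  refine ⟨hsub.lim, hμ.tendsto_gammaSeq A hφ hx hγ, ?_, η, ⟨hη, hηinv⟩, hηγ⟩
  suffices h : IsGreatest {r | ∃ η : Measure (X A), InvProb A η ∧ r = ∫ x, φ x ∂η} hsub.lim from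
    h.csSup_eq.symm
  refine ⟨⟨η, ⟨hη, hηinv⟩, hηγ.symm⟩, ?_⟩
  rintro _ ⟨ρ, ⟨hρ, hρinv⟩, rfl⟩
  refine ge_of_tendsto hγ ?_
  filter_upwards [eventually_gt_atTop 0] with n hn
  have hn' : (0 : ℝ) < n := by exact_mod_cast hn
  rw [le_div_iff₀ hn', mul_comm,
    ← integral_birkhoffSum ⟨(continuous_shift A).measurable, hρinv⟩
      (hφ.integrable_of_hasCompactSupport (HasCompactSupport.of_compactSpace _)) n]
  refine (integral_mono ((continuous_birkhoffSum (continuous_shift A) hφ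
    n).integrable_of_hasCompactSupport (HasCompactSupport.of_compactSpace _))
    (integrable_const _) fun y => hx n y).trans ?_
  simp

end RTSpec
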